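/- Let n ≥ 2, s > -1 and k ∈ {0,1,…,n}. There exist constants 0 < c < C < ∞ depending only on n, s, k such that for all integers p, q ≥ 0 with p+q > 0: c·[(p+1)(q+1)]^{2k} c_{pq,0}(s) ≤ c_{pq,k}(s) ≤ C·[(p+1)(q+1)]^{2k} c_{pq,0}(s). -/

import Mathlib

open MeasureTheory ENNReal NNReal

/-- Pochhammer symbol `(a)_k = Γ(a+k)/Γ(a)`. -/
noncomputable def poch (a : ℝ) (k : ℕ) : ℝ := Real.Gamma (a + k) / Real.Gamma a

/-- Gauss hypergeometric function `₂F₁(a,b;c;t)`, as a sum of its series. -/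
noncomputable def hyp2F1 (a b c t : ℝ) : ℝ :=
  ∑' k : ℕ, (poch a k * poch b k) / (poch c k * (Nat.factorial k)) * t ^ k

/-- `S_pq(t)`. -/
noncomputable def Spq (n p q : ℕ) (t : ℝ) : ℝ :=
  (Real.Gamma (n + p) * Real.Gamma (n + q)) / (Real.Gamma n * Real.Gamma ((n : ℝ) + p + q)) *
    hyp2F1 p q ((p : ℝ) + q + n) t

/-- `c_pq(s)`. -/
noncomputable def cpq (n p q : ℕ) (s : ℝ) : ℝ :=
  poch (s + 1) n / Real.Gamma n *
    ∫ t in Set.Ioo (0:ℝ) 1, t ^ ((p : ℝ) + q + n - 1) * (1 - t) ^ s * (Spq n p q t) ^ 2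

/-- The operator `u(t) ↦ 2t u'(t)`. -/
noncomputable def opD (g : ℝ → ℝ) : ℝ → ℝ := fun t => 2 * t * deriv g t

/-- `c_{pq,k}(s) = ∫₀¹ t^{n-1}(1-t)^s [(2t d/dt)^k (t^{(p+q)/2} S_pq(t))]² dt`. -/
noncomputable def cpqk (n p q : ℕ) (s : ℝ) (k : ℕ) : ℝ :=
  ∫ t in Set.Ioo (0:ℝ) 1, t ^ ((n : ℝ) - 1) * (1 - t) ^ s *
    (opD^[k] (fun u => u ^ (((p : ℝ) + q) / 2) * Spq n p q u) t) ^ 2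

/-- `I_pqs(ν,k) = ∫₀¹ t^{p+q+ν-1+k}(1-t)^s ₂F₁(p,q;p+q+ν;t)² dt`. -/
noncomputable def Ipqs (p q : ℕ) (s : ℝ) (ν k : ℕ) : ℝ :=
  ∫ t in Set.Ioo (0:ℝ) 1, t ^ ((p : ℝ) + q + ν - 1 + k) * (1 - t) ^ s *
    (hyp2F1 p q ((p : ℝ) + q + ν) t) ^ 2

theorem rpow_neg_sub_one_le_mul_sub {τ x : ℝ} (hτ : 0 < τ) (hx : 1 ≤ x) :
    x ^ (-τ - 1) ≤ (2 / τ + 1) * (x ^ (-τ) - (x + 1) ^ (-τ)) := by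
  have hx0 : 0 < x := by linarith
  have h1 : Real.exp (1 / (2 * x)) ≤ 1 + 1 / x := by
    have h := Real.add_one_le_exp (-(1 / (2 * x)))
    rw [Real.exp_neg] at h
    have h2 : (0:ℝ) < -(1 / (2 * x)) + 1 := by
      have : 1 / (2 * x) ≤ 1 / 2 := by gcongr; linarith
      linarith
    have h3 := inv_anti₀ h2 h
    rw [inv_inv] at h3
    refine h3.trans ?_
    rw [inv_le_iff_one_le_mul₀ h2]
    have : (1 + 1 / x) * (-(1 / (2 * x)) + 1) = 1 + (x - 1) / (2 * x ^ 2) := by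
      field_simp; ring
    rw [this]
    have : 0 ≤ (x - 1) / (2 * x ^ 2) := by apply div_nonneg <;> nlinarith
    linarith
  have h2 : (1 + 1 / x) ^ (-τ) ≤ 1 / (1 + τ / (2 * x)) := by
    have h3 : Real.exp (1 / (2 * x)) ^ τ ≤ (1 + 1 / x) ^ τ := by gcongr
    rw [← Real.exp_mul] at h3
    have h4 := Real.add_one_le_exp (1 / (2 * x) * τ)
    rw [Real.rpow_neg (by positivity), one_div (1 + τ / (2 * x))]
    apply inv_anti₀ (by positivity)
    calc _ = 1 / (2 * x) * τ + 1 := by ring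
      _ ≤ _ := h4.trans h3
  have h3 : (x + 1) ^ (-τ) = x ^ (-τ) * (1 + 1 / x) ^ (-τ) := by
    rw [← Real.mul_rpow (by positivity) (by positivity)]
    congr 1; field_simp
  have h4 : x ^ (-τ - 1) = x ^ (-τ) * (1 / x) := by
    rw [Real.rpow_sub_one hx0.ne']; ring
  rw [h3, h4]
  have h5 : 1 / x ≤ (2 / τ + 1) * (1 - 1 / (1 + τ / (2 * x))) := by
    have : (2 / τ + 1) * (1 - 1 / (1 + τ / (2 * x))) - 1 / x
        = (τ * x - τ) / (x * (2 * x + τ)) := by field_simp; ring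
    have h6 : 0 ≤ (τ * x - τ) / (x * (2 * x + τ)) := by
      apply div_nonneg _ (by positivity); nlinarith
    linarith
  have hp : 0 < x ^ (-τ) := by positivity
  calc x ^ (-τ) * (1 / x) ≤ x ^ (-τ) * ((2 / τ + 1) * (1 - (1 + 1 / x) ^ (-τ))) := by
        gcongr
        refine h5.trans ?_
        gcongr
    _ = _ := by ring

theorem sum_range_add_rpow_le {τ x : ℝ} (hτ : 0 < τ) (hx : 1 ≤ x) (N : ℕ) :
    ∑ j ∈ Finset.range N, (x + j) ^ (-τ - 1) ≤ (2 / τ + 1) * x ^ (-τ) := by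
  have h : ∀ j ∈ Finset.range N, (x + j) ^ (-τ - 1) ≤
      (2 / τ + 1) * ((x + j) ^ (-τ) - (x + (j + 1 : ℕ)) ^ (-τ)) := by
    intro j _
    have := rpow_neg_sub_one_le_mul_sub (x := x + j) hτ (by linarith [Nat.cast_nonneg (α := ℝ) j])
    push_cast
    rwa [← add_assoc]
  refine (Finset.sum_le_sum h).trans ?_
  rw [← Finset.mul_sum, Finset.sum_range_sub' (fun j : ℕ => (x + j) ^ (-τ))]
  have : 0 ≤ (x + N) ^ (-τ) := by positivity
  gcongr
  simpa using this

theorem exists_one_add_rpow_mul_exp_le (τ : ℝ) :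
    ∃ K : ℝ, 0 < K ∧ ∀ x : ℝ, 0 ≤ x → (1 + x) ^ τ * Real.exp (-x) ≤ K := by
  obtain ⟨N, hN⟩ := exists_nat_ge τ
  refine ⟨N.factorial * Real.exp 1, by positivity, fun x hx => ?_⟩
  have h1 : (1 + x) ^ τ ≤ (1 + x) ^ N := by
    rw [← Real.rpow_natCast]
    exact Real.rpow_le_rpow_of_exponent_le (by linarith) hN
  have h2 := Real.pow_div_factorial_le_exp (1 + x) (by linarith) N
  rw [div_le_iff₀ (by positivity)] at h2
  calc _ ≤ (Real.exp (1 + x) * N.factorial) * Real.exp (-x) := by gcongr; exact h1.trans h2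
    _ = N.factorial * (Real.exp (1 + x) * Real.exp (-x)) := by ring
    _ = _ := by rw [← Real.exp_add]; ring_nf

theorem exists_sum_rpow_mul_exp_le {τ : ℝ} (hτ : 0 < τ) :
    ∃ K : ℝ, 0 < K ∧ ∀ (m : ℕ) (M : ℝ), 1 ≤ m → 1 ≤ M → ∀ N : ℕ,
      ∑ j ∈ Finset.range N, ((m : ℝ) + 2 * j) ^ (-τ - 1) * Real.exp (-(M / (m + 2 * j)))
        ≤ K * M ^ (-τ) := by
  obtain ⟨K, hK, h⟩ := exists_one_add_rpow_mul_exp_le (τ + 1)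
  refine ⟨K * (2 / τ + 1), by positivity, fun m M hm hM N => ?_⟩
  have hm' : (1:ℝ) ≤ m := by exact_mod_cast hm
  calc _ ≤ ∑ j ∈ Finset.range N, K * (M + j) ^ (-τ - 1) := by
        apply Finset.sum_le_sum
        intro j _
        have hl : (0:ℝ) < m + 2 * j := by positivity
        have h1 := h (M / (m + 2 * j)) (by positivity)
        have h2 : (1 + M / (m + 2 * j)) = (M + (m + 2 * j)) / (m + 2 * j) := by field_simp; ring
        rw [h2, Real.div_rpow (by positivity) hl.le, div_mul_eq_mul_div, div_le_iff₀ (by positivity)] at h1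
        rw [show -τ - 1 = -(τ + 1) by ring, Real.rpow_neg hl.le, Real.rpow_neg (by positivity)]
        rw [inv_mul_eq_div, div_le_iff₀ (by positivity), mul_assoc, mul_comm _ (_ ^ (τ+1)),
          ← mul_assoc, ← div_eq_mul_inv, le_div_iff₀ (by positivity)]
        refine le_trans ?_ h1
        rw [mul_comm]
        gcongr
        linarith
    _ ≤ _ := by
        rw [← Finset.mul_sum, mul_assoc]
        gcongr
        exact sum_range_add_rpow_le hτ hM N

theorem factorial_quotient_step (P Q j : ℕ) :
    (((P + 1 + j).factorial * (Q + j).factorial : ℝ)) /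
        ((P + 1 + Q + 1 + j).factorial * j.factorial) =
      ((P + j).factorial * (Q + j).factorial) / ((P + Q + 1 + j).factorial * j.factorial) *
        ((P + 1 + j) / (P + 1 + (Q + 1) + j)) := by
  rw [show P + 1 + j = (P + j) + 1 by ring, show P + 1 + Q + 1 + j = (P + Q + 1 + j) + 1 by ring,
    Nat.factorial_succ, Nat.factorial_succ]
  push_cast
  field_simp
  ring

theorem factorial_quotient_zero (Q j : ℕ) :
    (((0 + j).factorial * (Q + j).factorial : ℝ)) /
        ((0 + Q + 1 + j).factorial * j.factorial) = 1 / (Q + 1 + j) := by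
  rw [show 0 + Q + 1 + j = (Q + j) + 1 by ring, Nat.factorial_succ, zero_add]
  push_cast
  field_simp
  ring

theorem factorial_quotient_le (P Q j : ℕ) (L : ℝ) (hL : (P : ℝ) + Q + 1 + j ≤ L) :
    (((P + j).factorial * (Q + j).factorial : ℝ)) /
        ((P + Q + 1 + j).factorial * j.factorial) ≤
      1 / (Q + 1 + j) * Real.exp (-((Q + 1) / L)) ^ P := by
  induction P with
  | zero => rw [factorial_quotient_zero]; simp
  | succ P ih =>
    push_cast at hL
    rw [factorial_quotient_step, pow_succ, ← mul_assoc]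
    have h := ih (by linarith)
    have h2 : ((P:ℝ) + 1 + j) / (P + 1 + (Q + 1) + j) ≤ Real.exp (-((Q + 1) / L)) := by
      have h3 := Real.add_one_le_exp (-((Q + 1 : ℝ) / L))
      refine le_trans ?_ h3
      have h4 : (Q + 1 : ℝ) / L ≤ (Q + 1) / (P + 1 + (Q + 1) + j) := by gcongr; linarith
      have h5 : ((P:ℝ) + 1 + j) / (P + 1 + (Q + 1) + j) = -((Q + 1) / (P + 1 + (Q + 1) + j)) + 1 := by
        field_simp; ring
      linarith
    gcongr

theorem le_factorial_quotient (P Q j : ℕ) (hj : 1 ≤ j) :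
    1 / (Q + 1 + j) * Real.exp (-((Q + 1) / j)) ^ P ≤
    (((P + j).factorial * (Q + j).factorial : ℝ)) /
        ((P + Q + 1 + j).factorial * j.factorial) := by
  have hj' : (1:ℝ) ≤ j := by exact_mod_cast hj
  induction P with
  | zero => rw [factorial_quotient_zero]; simp
  | succ P ih =>
    rw [factorial_quotient_step, pow_succ, ← mul_assoc]
    have h2 : Real.exp (-((Q + 1) / j)) ≤ ((P:ℝ) + 1 + j) / (P + 1 + (Q + 1) + j) := by
      have h3 := Real.add_one_le_exp ((Q + 1 : ℝ) / j)
      rw [Real.exp_neg, inv_le_comm₀ (by positivity) (by positivity)]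
      refine le_trans ?_ h3
      rw [inv_div, div_add_one (by positivity), div_le_div_iff₀ (by positivity) (by positivity)]
      nlinarith [mul_nonneg (Nat.cast_nonneg (α := ℝ) P) (Nat.cast_nonneg (α := ℝ) Q), Nat.cast_nonneg (α := ℝ) P, Nat.cast_nonneg (α := ℝ) Q]
    gcongr

/-- The `j`-th Taylor coefficient of `₂F₁(P+1, Q+1; P+Q+2+n; t)` without its `j`-independent
Gamma factors. -/
noncomputable def gaussCoeff (n P Q j : ℕ) : ℝ :=
  ((P + j).factorial * (Q + j).factorial) / ((P + Q + 1 + j + n).factorial * j.factorial)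

theorem gaussCoeff_pos (n P Q j : ℕ) : 0 < gaussCoeff n P Q j := by
  unfold gaussCoeff; positivity

theorem gaussCoeff_comm (n P Q j : ℕ) : gaussCoeff n P Q j = gaussCoeff n Q P j := by
  unfold gaussCoeff; rw [add_comm P Q, mul_comm ((P + j).factorial : ℝ)]

theorem gaussCoeff_le (n P Q j : ℕ) :
    gaussCoeff n P Q j ≤ 2 ^ (n + 1) * Real.exp 1 * (((P + Q + 2 : ℕ) : ℝ) + 2 * j)⁻¹ ^ (n + 1) *
      Real.exp (-((P + 1) * (Q + 1) / (((P + Q + 2 : ℕ) : ℝ) + 2 * j))) := by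
  wlog hPQ : P ≤ Q generalizing P Q with H
  · have := H Q P (by omega)
    rwa [gaussCoeff_comm, add_comm Q P, mul_comm ((Q : ℝ) + 1)] at this
  have hPQ' : (P : ℝ) ≤ Q := by exact_mod_cast hPQ
  set L : ℝ := ((P + Q + 2 : ℕ) : ℝ) + 2 * j with hL
  have hL' : L = P + Q + 2 + 2 * j := by rw [hL]; push_cast; ring
  have hLpos : 0 < L := by rw [hL']; positivity
  have h1 := factorial_quotient_le P Q j L (by rw [hL']; linarith [Nat.cast_nonneg (α := ℝ) j])
  have h2 : ((P + Q + 1 + j).factorial : ℝ) * (L / 2) ^ n ≤ (P + Q + 1 + j + n).factorial := by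
    have : ((P + Q + 1 + j).factorial : ℝ) * ((P + Q + 1 + j : ℕ) + 1) ^ n
        ≤ (P + Q + 1 + j + n).factorial := by
      exact_mod_cast Nat.factorial_mul_pow_le_factorial
    refine le_trans ?_ this
    gcongr
    rw [hL']; push_cast; linarith [Nat.cast_nonneg (α := ℝ) P, Nat.cast_nonneg (α := ℝ) Q]
  have h3 : (1:ℝ) / (Q + 1 + j) ≤ 1 / (L / 2) := by
    gcongr; rw [hL']; linarith
  have h4 : Real.exp (-((Q + 1) / L)) ^ P ≤ Real.exp 1 * Real.exp (-((P + 1) * (Q + 1) / L)) := by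
    rw [← Real.exp_nat_mul, ← Real.exp_add]
    gcongr
    have : (Q + 1) / L ≤ 1 := by
      rw [div_le_one hLpos, hL']
      linarith [Nat.cast_nonneg (α := ℝ) P, Nat.cast_nonneg (α := ℝ) j]
    have h5 : (P + 1 : ℝ) * (Q + 1) / L = P * ((Q + 1) / L) + (Q + 1) / L := by ring
    rw [h5]; linarith
  calc gaussCoeff n P Q j ≤ ((P + j).factorial * (Q + j).factorial) /
        (((P + Q + 1 + j).factorial * (L / 2) ^ n) * j.factorial) := by
        unfold gaussCoeff; gcongr
    _ = ((P + j).factorial * (Q + j).factorial) / ((P + Q + 1 + j).factorial * j.factorial) *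
        (1 / (L / 2)) ^ n := by
        rw [one_div, inv_pow]; field_simp
    _ ≤ (1 / (L / 2) * (Real.exp 1 * Real.exp (-((P + 1) * (Q + 1) / L)))) * (1 / (L / 2)) ^ n := by
        gcongr
        refine h1.trans ?_
        gcongr
    _ = _ := by
        rw [one_div_div, div_eq_mul_inv]; ring

theorem le_gaussCoeff (n P Q j : ℕ) (hj : (P + 1) * (Q + 1) ≤ j) (hj2 : j < 2 * ((P + 1) * (Q + 1))) :
    Real.exp (-1) / (3 * (4 + n) ^ n) * (((P + 1) * (Q + 1) : ℕ) : ℝ)⁻¹ ^ (n + 1) ≤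
      gaussCoeff n P Q j := by
  have hM1 : 1 ≤ (P + 1) * (Q + 1) := Nat.mul_pos (by omega) (by omega)
  have hPQ1 : P + Q + 1 ≤ (P + 1) * (Q + 1) := by nlinarith
  have hPQ2 : (P : ℝ) * (Q + 1) ≤ j := by
    have : P * (Q + 1) ≤ j := by nlinarith
    exact_mod_cast this
  set M := (P + 1) * (Q + 1) with hM
  have hj1 : 1 ≤ j := by omega
  have hMr : (1:ℝ) ≤ M := by exact_mod_cast hM1
  have hj1r : (1:ℝ) ≤ j := by exact_mod_cast hj1
  have h1 := le_factorial_quotient P Q j hj1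
  have h2 : ((P + Q + 1 + j + n).factorial : ℝ) ≤
      (P + Q + 1 + j).factorial * ((4 + n) * M) ^ n := by
    rw [← Nat.factorial_mul_ascFactorial]
    have h3 := Nat.ascFactorial_le_pow_add (P + Q + 1 + j) n
    have h4 : P + Q + 1 + j + n ≤ (4 + n) * M := by nlinarith
    have h5 := h3.trans (Nat.pow_le_pow_left h4 n)
    exact_mod_cast Nat.mul_le_mul_left _ h5
  have h3 : 1 / (3 * (M : ℝ)) ≤ 1 / (Q + 1 + j) := by
    gcongr
    have : Q + 1 + j ≤ 3 * M := by nlinarith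
    exact_mod_cast this
  have h4 : Real.exp (-1) ≤ Real.exp (-((Q + 1) / j)) ^ P := by
    rw [← Real.exp_nat_mul]
    gcongr
    have : (P : ℝ) * ((Q + 1) / j) ≤ 1 := by
      rw [mul_div, div_le_one (by positivity)]
      exact hPQ2
    linarith
  calc _ = (1 / (3 * (M : ℝ)) * Real.exp (-1)) * (1 / ((4 + n) * M)) ^ n := by
        rw [one_div ((4 + (n : ℝ)) * M), mul_inv, mul_pow, pow_succ, inv_pow (4 + (n : ℝ))]; field_simp
    _ ≤ ((P + j).factorial * (Q + j).factorial) / ((P + Q + 1 + j).factorial * j.factorial) *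
        (1 / ((4 + n) * M)) ^ n := by
        gcongr
        refine le_trans ?_ h1
        gcongr
    _ = ((P + j).factorial * (Q + j).factorial) /
        (((P + Q + 1 + j).factorial * ((4 + n) * M) ^ n) * j.factorial) := by
        rw [one_div, inv_pow]; field_simp
    _ ≤ _ := by unfold gaussCoeff; gcongr

/-- The generalized power series `∑ b_j (m+2j)^k t^{(m+2j)/2}`. -/
noncomputable def halfSeries (m : ℕ) (b : ℕ → ℝ) (k : ℕ) (t : ℝ) : ℝ :=
  ∑' j : ℕ, b j * ((m : ℝ) + 2 * j) ^ k * t ^ (((m : ℝ) + 2 * j) / 2)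

theorem rpow_half_eq (m j : ℕ) {t : ℝ} (ht : 0 < t) :
    t ^ (((m : ℝ) + 2 * j) / 2) = t ^ ((m : ℝ) / 2) * t ^ j := by
  rw [← Real.rpow_natCast t j, ← Real.rpow_add ht]; ring_nf

theorem summable_linear_pow_mul_geometric (m k : ℕ) {r : ℝ} (hr : 0 < r) (hr1 : r < 1) :
    Summable fun j : ℕ => ((m : ℝ) + 2 * j) ^ k * r ^ j := by
  have h := summable_pow_mul_geometric_of_norm_lt_one (R := ℝ) k (r := r)
    (by rwa [Real.norm_of_nonneg hr.le])
  have h2 := ((_root_.summable_nat_add_iff 1).2 h).mul_left (((m : ℝ) + 2) ^ k * r⁻¹)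
  refine Summable.of_nonneg_of_le (fun j => by positivity) (fun j => ?_) h2
  have : (m : ℝ) + 2 * j ≤ (m + 2) * (j + 1 : ℕ) := by
    push_cast
    nlinarith [mul_nonneg (Nat.cast_nonneg (α := ℝ) m) (Nat.cast_nonneg (α := ℝ) j)]
  calc ((m : ℝ) + 2 * j) ^ k * r ^ j ≤ ((m + 2) * (j + 1 : ℕ)) ^ k * r ^ j := by gcongr
    _ = _ := by rw [pow_succ r, mul_pow]; field_simp

theorem summable_halfSeries {m : ℕ} {b : ℕ → ℝ} {K : ℝ} (hb : ∀ j, 0 ≤ b j) (hK : ∀ j, b j ≤ K)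
    (k : ℕ) {t : ℝ} (ht : t ∈ Set.Ioo (0:ℝ) 1) :
    Summable fun j : ℕ => b j * ((m : ℝ) + 2 * j) ^ k * t ^ (((m : ℝ) + 2 * j) / 2) := by
  have h2 := (summable_linear_pow_mul_geometric m k ht.1 ht.2).mul_left (K * t ^ ((m:ℝ) / 2))
  have := ht.1
  refine Summable.of_nonneg_of_le (fun j => ?_) (fun j => ?_) h2
  · have := hb j; positivity
  · rw [rpow_half_eq m j ht.1]
    have := hK j
    calc _ ≤ K * ((m : ℝ) + 2 * j) ^ k * (t ^ ((m : ℝ) / 2) * t ^ j) := by gcongr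
      _ = _ := by ring

theorem hasDerivAt_halfSeries {m : ℕ} {b : ℕ → ℝ} {K : ℝ} (hb : ∀ j, 0 ≤ b j) (hK : ∀ j, b j ≤ K)
    (k : ℕ) {t : ℝ} (ht : t ∈ Set.Ioo (0:ℝ) 1) :
    HasDerivAt (halfSeries m b k) (halfSeries m b (k + 1) t / (2 * t)) t := by
  obtain ⟨ht0, ht1⟩ := ht
  obtain ⟨r, hr, hr1⟩ := exists_between ht1
  have hr0 : 0 < r := ht0.trans hr
  have hu := (summable_linear_pow_mul_geometric m (k + 1) hr0 hr1).mul_left (K * (t / 2)⁻¹)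
  have key := hasDerivAt_tsum_of_isPreconnected (𝕜 := ℝ) (F := ℝ)
    (g := fun (j : ℕ) (y : ℝ) => b j * ((m : ℝ) + 2 * j) ^ k * y ^ (((m : ℝ) + 2 * j) / 2))
    (g' := fun (j : ℕ) (y : ℝ) => b j * ((m : ℝ) + 2 * j) ^ k *
      ((((m : ℝ) + 2 * j) / 2) * y ^ (((m : ℝ) + 2 * j) / 2 - 1)))
    (t := Set.Ioo (t / 2) r) (y₀ := t) (y := t) hu isOpen_Ioo isPreconnected_Ioo
    (fun j y hy => ((Real.hasDerivAt_rpow_const (Or.inl (by linarith [hy.1]))).const_mul _))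
    (fun j y hy => ?_) ⟨by linarith, hr⟩
    (summable_halfSeries hb hK k ⟨ht0, ht1⟩) ⟨by linarith, hr⟩
  · have heq : halfSeries m b (k + 1) t / (2 * t) = ∑' j : ℕ, b j * ((m : ℝ) + 2 * j) ^ k *
      ((((m : ℝ) + 2 * j) / 2) * t ^ (((m : ℝ) + 2 * j) / 2 - 1)) := by
      unfold halfSeries
      rw [← tsum_div_const]
      congr 1; ext j
      rw [Real.rpow_sub_one ht0.ne', pow_succ]
      field_simp
    rw [heq]
    exact key
  · have hy0 : 0 < y := by linarith [hy.1]
    have hbj := hb j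
    have hKj := hK j
    have hK0 := hbj.trans hKj
    have hm : (((m : ℝ) + 2 * j) / 2) ≤ (m : ℝ) + 2 * j := by
      linarith [show (0:ℝ) ≤ (m : ℝ) + 2 * j by positivity]
    rw [Real.norm_of_nonneg (by positivity), Real.rpow_sub_one hy0.ne', rpow_half_eq m j hy0,
      div_eq_mul_inv _ y]
    have h1 : y ^ ((m : ℝ) / 2) ≤ 1 :=
      Real.rpow_le_one hy0.le (by linarith [hy.2]) (by positivity)
    have h2 : y⁻¹ ≤ (t / 2)⁻¹ := inv_anti₀ (by positivity) hy.1.le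
    have h3 : y ^ j ≤ r ^ j := pow_le_pow_left₀ hy0.le hy.2.le j
    calc _ ≤ K * ((m : ℝ) + 2 * j) ^ k * (((m : ℝ) + 2 * j) * (1 * r ^ j * (t / 2)⁻¹)) := by
          gcongr
      _ = _ := by ring

theorem iterate_opD_eq_halfSeries {m : ℕ} {b : ℕ → ℝ} {K : ℝ} (hb : ∀ j, 0 ≤ b j)
    (hK : ∀ j, b j ≤ K) {f : ℝ → ℝ} (hf : ∀ t ∈ Set.Ioo (0:ℝ) 1, f t = halfSeries m b 0 t)
    (k : ℕ) : ∀ t ∈ Set.Ioo (0:ℝ) 1, opD^[k] f t = halfSeries m b k t := by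
  induction k with
  | zero => exact hf
  | succ k ih =>
    intro t ht
    have hev : opD^[k] f =ᶠ[nhds t] halfSeries m b k :=
      Filter.eventuallyEq_of_mem (isOpen_Ioo.mem_nhds ht) ih
    have := ht.1
    rw [Function.iterate_succ_apply', opD, hev.deriv_eq, (hasDerivAt_halfSeries hb hK k ht).deriv]
    field_simp

theorem Spq_eq_zero (n p q : ℕ) (h : p = 0 ∨ q = 0) (t : ℝ) : Spq n p q t = 0 := by
  have h0 : ∀ k, poch p k * poch q k = 0 := by
    intro k
    rcases h with rfl | rfl <;> simp [poch]
  simp [Spq, hyp2F1, h0]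

theorem cpqk_eq_zero (n p q : ℕ) (h : p = 0 ∨ q = 0) (s : ℝ) (k : ℕ) : cpqk n p q s k = 0 := by
  have hf : (fun u : ℝ => u ^ (((p : ℝ) + q) / 2) * Spq n p q u) = 0 := by
    ext u; simp [Spq_eq_zero n p q h]
  have hk : opD^[k] (0 : ℝ → ℝ) = 0 := by
    induction k with
    | zero => rfl
    | succ k ih => rw [Function.iterate_succ_apply', ih]; ext t; simp [opD]
  simp [cpqk, hf, hk]

/-- The `j`-independent factor of the Taylor coefficients of `S_pq`. -/
noncomputable def SpqScale (n P Q : ℕ) : ℝ :=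
  (Real.Gamma (n + (P + 1 : ℕ)) * Real.Gamma (n + (Q + 1 : ℕ))) /
    (Real.Gamma n * Real.Gamma ((n : ℝ) + (P + 1 : ℕ) + (Q + 1 : ℕ))) *
    ((P + Q + 1 + n).factorial / (P.factorial * Q.factorial))

theorem SpqScale_pos {n : ℕ} (hn : 0 < n) (P Q : ℕ) : 0 < SpqScale n P Q := by
  have hn' : (0:ℝ) < n := by exact_mod_cast hn
  have h1 := Real.Gamma_pos_of_pos hn'
  have h2 : 0 < Real.Gamma (n + (P + 1 : ℕ)) := Real.Gamma_pos_of_pos (by positivity)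
  have h3 : 0 < Real.Gamma (n + (Q + 1 : ℕ)) := Real.Gamma_pos_of_pos (by positivity)
  have h4 : 0 < Real.Gamma ((n : ℝ) + (P + 1 : ℕ) + (Q + 1 : ℕ)) :=
    Real.Gamma_pos_of_pos (by positivity)
  unfold SpqScale; positivity

theorem poch_natCast_succ (P j : ℕ) : poch ((P + 1 : ℕ) : ℝ) j = (P + j).factorial / P.factorial := by
  unfold poch
  rw [Nat.cast_succ, Real.Gamma_nat_eq_factorial, ← Real.Gamma_nat_eq_factorial (P + j)]
  push_cast
  ring_nf

theorem rpow_mul_Spq (n P Q : ℕ) {t : ℝ} (ht : t ∈ Set.Ioo (0:ℝ) 1) :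
    t ^ ((((P + 1 : ℕ) : ℝ) + (Q + 1 : ℕ)) / 2) * Spq n (P + 1) (Q + 1) t =
      halfSeries (P + Q + 2) (fun j => SpqScale n P Q * gaussCoeff n P Q j) 0 t := by
  unfold halfSeries Spq hyp2F1
  rw [← mul_assoc, ← _root_.tsum_mul_left]
  congr 1; ext j
  rw [rpow_half_eq _ _ ht.1, poch_natCast_succ, poch_natCast_succ,
    show ((P + 1 : ℕ) : ℝ) + (Q + 1 : ℕ) + n = ((P + Q + 1 + n + 1 : ℕ) : ℝ) by push_cast; ring,
    poch_natCast_succ]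
  simp only [SpqScale, gaussCoeff]
  rw [show P + Q + 1 + n + j = P + Q + 1 + j + n by ring,
    show ((P + 1 : ℕ) : ℝ) + (Q + 1 : ℕ) = ((P + Q + 2 : ℕ) : ℝ) by push_cast; ring]
  have h1 := (P.factorial_pos)
  field_simp

theorem lintegral_rpow_mul_one_sub_rpow_le {s L : ℝ} (hs : -1 < s) (hL : 0 < L) :
    ∫⁻ t in Set.Ioo (0:ℝ) 1, ENNReal.ofReal (t ^ L * (1 - t) ^ s) ≤
      ENNReal.ofReal (Real.Gamma (s + 1) * L ^ (-(s + 1))) := by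
  have hint : IntegrableOn (fun x : ℝ => x ^ s * Real.exp (-(L * x))) (Set.Ioi 0) := by
    have := integrableOn_rpow_mul_exp_neg_mul_rpow (s := s) (p := 1) (b := L) hs one_pos hL
    simpa using this
  have hval := Real.integral_rpow_mul_exp_neg_mul_Ioi (a := s + 1) (r := L) (by linarith) hL
  rw [add_sub_cancel_right, one_div, Real.inv_rpow hL.le, ← Real.rpow_neg hL.le, mul_comm] at hval
  rw [← hval, ofReal_integral_eq_lintegral_ofReal hint]
  · rw [← lintegral_indicator measurableSet_Ioi, ← lintegral_sub_left_eq_self (μ := volume) _ (1:ℝ),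
      ← lintegral_indicator measurableSet_Ioo]
    refine lintegral_mono fun t => ?_
    by_cases ht : t ∈ Set.Ioo (0:ℝ) 1
    · rw [Set.indicator_of_mem ht, Set.indicator_of_mem (by simpa using ht.2)]
      apply ENNReal.ofReal_le_ofReal
      have h1 : t ^ L ≤ Real.exp (-(L * (1 - t))) := by
        have h2 := Real.add_one_le_exp (-(1 - t))
        calc t ^ L ≤ (Real.exp (-(1 - t))) ^ L :=
              Real.rpow_le_rpow ht.1.le (by linarith) hL.le
          _ = _ := by rw [← Real.exp_mul]; ring_nf
      have h3 : 0 ≤ (1 - t) ^ s := Real.rpow_nonneg (by linarith [ht.2]) _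
      rw [mul_comm]
      gcongr
    · rw [Set.indicator_of_notMem ht]; exact zero_le
  · refine (ae_restrict_mem measurableSet_Ioi).mono fun x hx => ?_
    have hx : (0:ℝ) < x := hx
    simp only [Pi.zero_apply]
    positivity

theorem halfSeries_sq_le {m : ℕ} (hm : 1 ≤ m) {b : ℕ → ℝ} {K : ℝ} (hb : ∀ j, 0 ≤ b j)
    (hK : ∀ j, b j ≤ K) (k : ℕ) {σ W : ℝ}
    (hW : ∀ N, ∑ j ∈ Finset.range N, b j * ((m : ℝ) + 2 * j) ^ k * ((m : ℝ) + 2 * j) ^ (-σ) ≤ W)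
    {t : ℝ} (ht : t ∈ Set.Ioo (0:ℝ) 1) :
    ENNReal.ofReal (halfSeries m b k t ^ 2) ≤ ENNReal.ofReal W * ∑' j : ℕ,
      ENNReal.ofReal (b j * ((m : ℝ) + 2 * j) ^ k * ((m : ℝ) + 2 * j) ^ σ *
        t ^ ((m : ℝ) + 2 * j)) := by
  have hm' : (1:ℝ) ≤ m := by exact_mod_cast hm
  have ht0 := ht.1
  have hW0 : 0 ≤ W := by simpa using hW 0
  have hlim := (summable_halfSeries (m := m) hb hK k ht).hasSum.tendsto_sum_nat
  refine le_of_tendsto ((ENNReal.continuous_ofReal.tendsto _).comp (hlim.pow 2))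
    (Filter.Eventually.of_forall fun N => ?_)
  have h0 : ∀ j : ℕ, 0 ≤ b j * ((m : ℝ) + 2 * j) ^ k * ((m : ℝ) + 2 * j) ^ (-σ) := fun j => by
    have := hb j; positivity
  have h1 : ∀ j : ℕ, 0 ≤ b j * ((m : ℝ) + 2 * j) ^ k * ((m : ℝ) + 2 * j) ^ σ *
        t ^ ((m : ℝ) + 2 * j) := fun j => by
    have := hb j; positivity
  have hcs := Finset.sum_sq_le_sum_mul_sum_of_sq_le_mul (Finset.range N)
    (r := fun j : ℕ => b j * ((m : ℝ) + 2 * j) ^ k * t ^ (((m : ℝ) + 2 * j) / 2))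
    (f := fun j : ℕ => b j * ((m : ℝ) + 2 * j) ^ k * ((m : ℝ) + 2 * j) ^ (-σ))
    (g := fun j : ℕ => b j * ((m : ℝ) + 2 * j) ^ k * ((m : ℝ) + 2 * j) ^ σ *
        t ^ ((m : ℝ) + 2 * j)) (fun j _ => h0 j) (fun j _ => h1 j) (fun j _ => by
      have hl : (0:ℝ) < m + 2 * j := by positivity
      have e1 : t ^ ((m : ℝ) + 2 * j) = (t ^ (((m : ℝ) + 2 * j) / 2)) ^ 2 := by
        rw [← Real.rpow_natCast, ← Real.rpow_mul ht0.le]; congr 1; push_cast; ring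
      have e2 : ((m : ℝ) + 2 * j) ^ (-σ) * ((m : ℝ) + 2 * j) ^ σ = 1 := by
        rw [← Real.rpow_add hl]; simp
      rw [e1]
      apply le_of_eq
      linear_combination (-(b j * ((m : ℝ) + 2 * j) ^ k * t ^ (((m : ℝ) + 2 * j) / 2)) ^ 2) * e2)
  calc _ ≤ ENNReal.ofReal (W * ∑ j ∈ Finset.range N, b j * ((m : ℝ) + 2 * j) ^ k *
        ((m : ℝ) + 2 * j) ^ σ * t ^ ((m : ℝ) + 2 * j)) := by
        apply ENNReal.ofReal_le_ofReal
        refine hcs.trans ?_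
        gcongr
        · exact Finset.sum_nonneg fun j _ => h1 j
        · exact hW N
    _ ≤ _ := by
        rw [ENNReal.ofReal_mul hW0, ENNReal.ofReal_sum_of_nonneg fun j _ => h1 j]
        gcongr
        exact ENNReal.sum_le_tsum _

theorem lintegral_halfSeries_le {n m : ℕ} (hn : 1 ≤ n) (hm : 1 ≤ m) {b : ℕ → ℝ} {K : ℝ}
    (hb : ∀ j, 0 ≤ b j) (hK : ∀ j, b j ≤ K) (k : ℕ) {s W : ℝ} (hs : -1 < s)
    (hW : ∀ N, ∑ j ∈ Finset.range N,
      b j * ((m : ℝ) + 2 * j) ^ k * ((m : ℝ) + 2 * j) ^ (-((s + 1) / 2)) ≤ W) :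
    ∫⁻ t in Set.Ioo (0:ℝ) 1,
      ENNReal.ofReal (t ^ ((n : ℝ) - 1) * (1 - t) ^ s * halfSeries m b k t ^ 2) ≤
      ENNReal.ofReal (Real.Gamma (s + 1) * W ^ 2) := by
  have hm' : (1:ℝ) ≤ m := by exact_mod_cast hm
  have hn' : (1:ℝ) ≤ n := by exact_mod_cast hn
  have hW0 : 0 ≤ W := by simpa using hW 0
  have hG : 0 < Real.Gamma (s + 1) := Real.Gamma_pos_of_pos (by linarith)
  have hβ : ∀ j : ℕ, 0 ≤ b j * ((m : ℝ) + 2 * j) ^ k * ((m : ℝ) + 2 * j) ^ ((s + 1) / 2) :=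
    fun j => by have := hb j; positivity
  calc _ ≤ ∫⁻ t in Set.Ioo (0:ℝ) 1, ENNReal.ofReal W * ∑' j : ℕ,
        ENNReal.ofReal (b j * ((m : ℝ) + 2 * j) ^ k * ((m : ℝ) + 2 * j) ^ ((s + 1) / 2)) *
          ENNReal.ofReal (t ^ ((m : ℝ) + 2 * j) * (1 - t) ^ s) := by
        refine setLIntegral_mono' measurableSet_Ioo fun t ht => ?_
        have ht0 := ht.1
        have h1t : 0 ≤ (1 - t) ^ s := Real.rpow_nonneg (by linarith [ht.2]) _
        have h1 : t ^ ((n : ℝ) - 1) ≤ 1 := Real.rpow_le_one ht.1.le ht.2.le (by linarith)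
        calc _ ≤ ENNReal.ofReal ((1 - t) ^ s * halfSeries m b k t ^ 2) := by
              apply ENNReal.ofReal_le_ofReal
              calc _ ≤ 1 * (1 - t) ^ s * halfSeries m b k t ^ 2 := by gcongr
                _ = _ := by ring
          _ ≤ ENNReal.ofReal ((1 - t) ^ s) * (ENNReal.ofReal W * ∑' j : ℕ,
              ENNReal.ofReal (b j * ((m : ℝ) + 2 * j) ^ k * ((m : ℝ) + 2 * j) ^ ((s + 1) / 2) *
              t ^ ((m : ℝ) + 2 * j))) := by
              rw [ENNReal.ofReal_mul h1t]
              gcongr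
              exact halfSeries_sq_le hm hb hK k hW ht
          _ = _ := by
              rw [mul_left_comm, ← ENNReal.tsum_mul_left]
              congr 2; ext j
              rw [← ENNReal.ofReal_mul (hβ j), ← ENNReal.ofReal_mul h1t]
              congr 1; ring
    _ = ENNReal.ofReal W * ∑' j : ℕ,
        ENNReal.ofReal (b j * ((m : ℝ) + 2 * j) ^ k * ((m : ℝ) + 2 * j) ^ ((s + 1) / 2)) *
          ∫⁻ t in Set.Ioo (0:ℝ) 1, ENNReal.ofReal (t ^ ((m : ℝ) + 2 * j) * (1 - t) ^ s) := by
        rw [lintegral_const_mul' _ _ ENNReal.ofReal_ne_top, lintegral_tsum]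
        · congr 2; ext j
          rw [lintegral_const_mul' _ _ ENNReal.ofReal_ne_top]
        · intro j
          fun_prop
    _ ≤ ENNReal.ofReal W * ∑' j : ℕ, ENNReal.ofReal (Real.Gamma (s + 1) *
          (b j * ((m : ℝ) + 2 * j) ^ k * ((m : ℝ) + 2 * j) ^ (-((s + 1) / 2)))) := by
        gcongr with j
        have hl : (0:ℝ) < m + 2 * j := by positivity
        refine (mul_le_mul_right (lintegral_rpow_mul_one_sub_rpow_le hs hl) _).trans ?_
        rw [← ENNReal.ofReal_mul (hβ j)]
        apply le_of_eq
        congr 1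
        rw [show -((s + 1) / 2) = (s + 1) / 2 + -(s + 1) by ring, Real.rpow_add hl]
        ring
    _ ≤ ENNReal.ofReal W * ENNReal.ofReal (Real.Gamma (s + 1) * W) := by
        gcongr
        rw [ENNReal.tsum_eq_iSup_nat]
        refine iSup_le fun N => ?_
        rw [← ENNReal.ofReal_sum_of_nonneg, ← Finset.mul_sum]
        · apply ENNReal.ofReal_le_ofReal
          gcongr
          exact hW N
        · intro j _
          have := hb j; positivity
    _ = _ := by rw [← ENNReal.ofReal_mul hW0]; congr 1; ring

theorem integrableOn_halfSeries {n m : ℕ} (hn : 1 ≤ n) (hm : 1 ≤ m) {b : ℕ → ℝ} {K : ℝ}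
    (hb : ∀ j, 0 ≤ b j) (hK : ∀ j, b j ≤ K) (k : ℕ) {s W : ℝ} (hs : -1 < s)
    (hW : ∀ N, ∑ j ∈ Finset.range N,
      b j * ((m : ℝ) + 2 * j) ^ k * ((m : ℝ) + 2 * j) ^ (-((s + 1) / 2)) ≤ W) :
    IntegrableOn (fun t => t ^ ((n : ℝ) - 1) * (1 - t) ^ s * halfSeries m b k t ^ 2)
      (Set.Ioo (0:ℝ) 1) ∧
    ∫ t in Set.Ioo (0:ℝ) 1, t ^ ((n : ℝ) - 1) * (1 - t) ^ s * halfSeries m b k t ^ 2 ≤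
      Real.Gamma (s + 1) * W ^ 2 := by
  have hle := lintegral_halfSeries_le hn hm hb hK k hs hW
  have hG : 0 < Real.Gamma (s + 1) := Real.Gamma_pos_of_pos (by linarith)
  have hcont : ContinuousOn (halfSeries m b k) (Set.Ioo (0:ℝ) 1) := fun t ht =>
    (hasDerivAt_halfSeries hb hK k ht).continuousAt.continuousWithinAt
  have hmeas : AEStronglyMeasurable
      (fun t => t ^ ((n : ℝ) - 1) * (1 - t) ^ s * halfSeries m b k t ^ 2)
      (volume.restrict (Set.Ioo (0:ℝ) 1)) :=
    (Measurable.aestronglyMeasurable (by fun_prop)).mul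
      ((hcont.aestronglyMeasurable measurableSet_Ioo).pow 2)
  have hnn : 0 ≤ᵐ[volume.restrict (Set.Ioo (0:ℝ) 1)]
      (fun t => t ^ ((n : ℝ) - 1) * (1 - t) ^ s * halfSeries m b k t ^ 2) := by
    refine (ae_restrict_mem measurableSet_Ioo).mono fun t ht => ?_
    have ht0 := ht.1
    have h1t : 0 ≤ (1 - t) ^ s := Real.rpow_nonneg (by linarith [ht.2]) _
    simp only [Pi.zero_apply]
    positivity
  refine ⟨⟨hmeas, ?_⟩, ?_⟩
  · rw [hasFiniteIntegral_iff_ofReal hnn]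
    exact hle.trans_lt ENNReal.ofReal_lt_top
  · rw [integral_eq_lintegral_of_nonneg_ae hnn hmeas]
    exact ENNReal.toReal_le_of_le_ofReal (by positivity) hle

theorem le_integral_halfSeries {n m : ℕ} (hn : 1 ≤ n) {b : ℕ → ℝ} {K β : ℝ}
    (hb : ∀ j, 0 ≤ b j) (hK : ∀ j, b j ≤ K) (k : ℕ) {s : ℝ} (hs : -1 < s) {M : ℕ} (hM : 1 ≤ M)
    (hmM : m ≤ 2 * M) (hβ : 0 ≤ β) (hbβ : ∀ j, M ≤ j → j < 2 * M → β ≤ b j)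
    (hint : IntegrableOn (fun t => t ^ ((n : ℝ) - 1) * (1 - t) ^ s * halfSeries m b k t ^ 2)
      (Set.Ioo (0:ℝ) 1)) :
    (3 / 4) ^ ((n : ℝ) - 1) * (1 / 16) * ((4 * M : ℝ) ^ (-(s + 1)) / (s + 1)) *
      (M * (β * M ^ k)) ^ 2 ≤
    ∫ t in Set.Ioo (0:ℝ) 1, t ^ ((n : ℝ) - 1) * (1 - t) ^ s * halfSeries m b k t ^ 2 := by
  have hMr : (1:ℝ) ≤ M := by exact_mod_cast hM
  have hmMr : (m:ℝ) ≤ 2 * M := by exact_mod_cast hmM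
  have hn' : (1:ℝ) ≤ n := by exact_mod_cast hn
  set δ : ℝ := 1 / (4 * M) with hδ
  have hδ0 : 0 < δ := by positivity
  have hδ1 : δ ≤ 1 / 4 := by
    rw [hδ]; apply one_div_le_one_div_of_le <;> linarith
  have hpt : ∀ t ∈ Set.Ioo (1 - δ) 1, M * (β * M ^ k) * (1 / 4) ≤ halfSeries m b k t := by
    intro t ht
    have ht0 : 0 < t := by linarith [ht.1]
    have htI : t ∈ Set.Ioo (0:ℝ) 1 := ⟨ht0, ht.2⟩
    have hterm : ∀ j ∈ Finset.Ico M (2 * M), β * (M : ℝ) ^ k * (1 / 4) ≤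
        b j * ((m : ℝ) + 2 * j) ^ k * t ^ (((m : ℝ) + 2 * j) / 2) := by
      intro j hj
      rw [Finset.mem_Ico] at hj
      have hj1 : (M : ℝ) ≤ j := by exact_mod_cast hj.1
      have hj2 : (j : ℝ) ≤ 2 * M := by exact_mod_cast hj.2.le
      have h1 := hbβ j hj.1 hj.2
      have h2 : (M : ℝ) ≤ m + 2 * j := by linarith [Nat.cast_nonneg (α := ℝ) m]
      have h3 : (1:ℝ) / 4 ≤ t ^ (((m : ℝ) + 2 * j) / 2) := by
        have h4 := one_add_mul_self_le_rpow_one_add (s := -δ) (by linarith) (p := 3 * M)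
          (by linarith)
        have h5 : 1 + 3 * (M : ℝ) * -δ = 1 / 4 := by rw [hδ]; field_simp; ring
        rw [h5] at h4
        calc (1:ℝ) / 4 ≤ (1 + -δ) ^ (3 * (M : ℝ)) := h4
          _ ≤ t ^ (3 * (M : ℝ)) := by
            apply Real.rpow_le_rpow <;> linarith [ht.1]
          _ ≤ _ := Real.rpow_le_rpow_of_exponent_ge ht0 ht.2.le (by linarith)
      have := hb j
      gcongr
    have hs1 := (summable_halfSeries (m := m) hb hK k htI).sum_le_tsum (Finset.Ico M (2 * M))
      (fun j _ => by have := hb j; positivity)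
    have hs2 := Finset.card_nsmul_le_sum _ _ _ hterm
    rw [Nat.card_Ico, nsmul_eq_mul, show 2 * M - M = M by omega] at hs2
    calc _ = (M : ℝ) * (β * (M : ℝ) ^ k * (1 / 4)) := by ring
      _ ≤ _ := hs2.trans hs1
  have hsub : Set.Ioo (1 - δ) 1 ⊆ Set.Ioo (0:ℝ) 1 := Set.Ioo_subset_Ioo_left (by linarith)
  have hval : ∫ t in Set.Ioo (1 - δ) 1, (1 - t) ^ s = δ ^ (s + 1) / (s + 1) := by
    rw [← integral_Ioc_eq_integral_Ioo, ← intervalIntegral.integral_of_le (by linarith),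
      intervalIntegral.integral_comp_sub_left (fun x : ℝ => x ^ s) 1, integral_rpow (Or.inl hs)]
    rw [sub_self, show 1 - (1 - δ) = δ by ring, Real.zero_rpow (by linarith), sub_zero]
  have hI : IntegrableOn (fun t : ℝ => (1 - t) ^ s) (Set.Ioo (1 - δ) 1) := by
    have h := (intervalIntegral.intervalIntegrable_rpow' (a := δ) (b := 0) hs).comp_sub_left 1
    rw [intervalIntegrable_iff_integrableOn_Ioo_of_le (by linarith)] at h
    simpa using h
  have hδe : δ ^ (s + 1) = (4 * M : ℝ) ^ (-(s + 1)) := by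
    rw [hδ, one_div, Real.inv_rpow (by positivity), Real.rpow_neg (by positivity)]
  rw [← hδe, ← hval]
  calc _ = ∫ t in Set.Ioo (1 - δ) 1, (3 / 4 : ℝ) ^ ((n : ℝ) - 1) * (1 - t) ^ s *
        (M * (β * M ^ k) * (1 / 4)) ^ 2 := by
        rw [integral_mul_const, integral_const_mul]; ring
    _ ≤ ∫ t in Set.Ioo (1 - δ) 1,
        t ^ ((n : ℝ) - 1) * (1 - t) ^ s * halfSeries m b k t ^ 2 := by
        refine setIntegral_mono_on ((hI.const_mul _).mul_const _) (hint.mono_set hsub)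
          measurableSet_Ioo fun t ht => ?_
        have h1t : 0 ≤ (1 - t) ^ s := Real.rpow_nonneg (by linarith [ht.2]) _
        have ht0 : 0 < t := by linarith [ht.1]
        have := hpt t ht
        gcongr
        linarith [ht.1]
    _ ≤ _ := by
        refine setIntegral_mono_set hint ?_ hsub.eventuallyLE
        refine (ae_restrict_mem measurableSet_Ioo).mono fun t ht => ?_
        have ht0 := ht.1
        have h1t : 0 ≤ (1 - t) ^ s := Real.rpow_nonneg (by linarith [ht.2]) _
        simp only [Pi.zero_apply]
        positivity

theorem cpqk_eq_integral_halfSeries (n P Q : ℕ) (s : ℝ) (k : ℕ) {K : ℝ} (hn : 1 ≤ n)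
    (hK : ∀ j, SpqScale n P Q * gaussCoeff n P Q j ≤ K) :
    cpqk n (P + 1) (Q + 1) s k = ∫ t in Set.Ioo (0:ℝ) 1, t ^ ((n : ℝ) - 1) * (1 - t) ^ s *
      halfSeries (P + Q + 2) (fun j => SpqScale n P Q * gaussCoeff n P Q j) k t ^ 2 := by
  refine setIntegral_congr_fun measurableSet_Ioo fun t ht => ?_
  have hb : ∀ j, 0 ≤ SpqScale n P Q * gaussCoeff n P Q j := fun j =>
    (mul_pos (SpqScale_pos hn P Q) (gaussCoeff_pos n P Q j)).le
  rw [iterate_opD_eq_halfSeries (m := P + Q + 2) hb hK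
    (fun t ht => rpow_mul_Spq n P Q ht) k t ht]

theorem exists_cpqk_bounds {n : ℕ} (hn : 1 ≤ n) {s : ℝ} (hs : -1 < s) {k : ℕ} (hk : k ≤ n) :
    ∃ κ K : ℝ, 0 < κ ∧ 0 < K ∧ ∀ P Q : ℕ,
      κ * (((P + 1) * (Q + 1) : ℕ) : ℝ) ^ (2 * k) *
        (SpqScale n P Q ^ 2 * (((P + 1) * (Q + 1) : ℕ) : ℝ) ^ (-(2 * n + s + 1))) ≤
          cpqk n (P + 1) (Q + 1) s k ∧
      cpqk n (P + 1) (Q + 1) s k ≤ K * (((P + 1) * (Q + 1) : ℕ) : ℝ) ^ (2 * k) *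
        (SpqScale n P Q ^ 2 * (((P + 1) * (Q + 1) : ℕ) : ℝ) ^ (-(2 * n + s + 1))) := by
  have hs1 : 0 < s + 1 := by linarith
  have hG : 0 < Real.Gamma (s + 1) := Real.Gamma_pos_of_pos hs1
  have hk' : (k : ℝ) ≤ n := by exact_mod_cast hk
  set τ : ℝ := n - k + (s + 1) / 2 with hτ
  have hτ0 : 0 < τ := by linarith
  obtain ⟨K₁, hK₁, hsum⟩ := exists_sum_rpow_mul_exp_le hτ0
  set c₁ : ℝ := 2 ^ (n + 1) * Real.exp 1 with hc₁
  set c₀ : ℝ := Real.exp (-1) / (3 * (4 + n) ^ n) with hc₀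
  refine ⟨(3 / 4) ^ ((n : ℝ) - 1) * (1 / 16) * (4 ^ (-(s + 1)) / (s + 1)) * c₀ ^ 2,
    Real.Gamma (s + 1) * (c₁ * K₁) ^ 2, by positivity, by positivity, fun P Q => ?_⟩
  have hA := SpqScale_pos hn P Q
  set A := SpqScale n P Q with hAdef
  have hb : ∀ j, 0 ≤ A * gaussCoeff n P Q j := fun j => (mul_pos hA (gaussCoeff_pos n P Q j)).le
  have hM1 : 1 ≤ (P + 1) * (Q + 1) := Nat.mul_pos (by omega) (by omega)
  have hmM : P + Q + 2 ≤ 2 * ((P + 1) * (Q + 1)) := by nlinarith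
  have hlow : ∀ j, (P + 1) * (Q + 1) ≤ j → j < 2 * ((P + 1) * (Q + 1)) →
      A * (c₀ * (((P + 1) * (Q + 1) : ℕ) : ℝ)⁻¹ ^ (n + 1)) ≤ A * gaussCoeff n P Q j :=
    fun j h1 h2 => mul_le_mul_of_nonneg_left (le_gaussCoeff n P Q j h1 h2) hA.le
  have hup := gaussCoeff_le n P Q
  have hcast : ((P : ℝ) + 1) * (Q + 1) = (((P + 1) * (Q + 1) : ℕ) : ℝ) := by push_cast; ring
  rw [hcast] at hup
  generalize hMdef : (P + 1) * (Q + 1) = M at *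
  have hMr : (1:ℝ) ≤ M := by exact_mod_cast hM1
  have hM0 : (0:ℝ) < M := by linarith
  have hlpos : ∀ j : ℕ, (1:ℝ) ≤ ((P + Q + 2 : ℕ) : ℝ) + 2 * j := fun j => by
    push_cast
    linarith [Nat.cast_nonneg (α := ℝ) P, Nat.cast_nonneg (α := ℝ) Q, Nat.cast_nonneg (α := ℝ) j]
  have hK : ∀ j, A * gaussCoeff n P Q j ≤ A * (c₁ * 1 ^ (n + 1) * 1) := fun j => by
    refine mul_le_mul_of_nonneg_left ((hup j).trans ?_) hA.le
    have h0 := hlpos j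
    gcongr
    · exact inv_le_one_of_one_le₀ h0
    · rw [Real.exp_le_one_iff, neg_nonpos]; positivity
  have hW : ∀ N, ∑ j ∈ Finset.range N, A * gaussCoeff n P Q j *
      (((P + Q + 2 : ℕ) : ℝ) + 2 * j) ^ k * (((P + Q + 2 : ℕ) : ℝ) + 2 * j) ^ (-((s + 1) / 2)) ≤
      A * c₁ * (K₁ * (M : ℝ) ^ (-τ)) := by
    intro N
    refine le_trans ?_ (mul_le_mul_of_nonneg_left (hsum (P + Q + 2) M (by omega) hMr N)
      (by positivity))
    rw [Finset.mul_sum]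
    refine Finset.sum_le_sum fun j _ => ?_
    have hj := hup j
    have hl := hlpos j
    generalize ((P + Q + 2 : ℕ) : ℝ) + 2 * j = L at *
    have hL0 : 0 < L := by linarith
    have hexp : L ^ (-τ - 1) = L⁻¹ ^ (n + 1) * L ^ k * L ^ (-((s + 1) / 2)) := by
      rw [← Real.rpow_natCast, ← Real.rpow_natCast, Real.inv_rpow hL0.le, ← Real.rpow_neg hL0.le,
        ← Real.rpow_add hL0, ← Real.rpow_add hL0]
      congr 1; rw [hτ]; push_cast; ring
    rw [hexp]
    calc _ ≤ A * (c₁ * L⁻¹ ^ (n + 1) * Real.exp (-(M / L))) * L ^ k * L ^ (-((s + 1) / 2)) := by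
          gcongr
      _ = _ := by ring
  obtain ⟨hint, hle⟩ := integrableOn_halfSeries hn (m := P + Q + 2) (by omega) hb hK k hs hW
  have hge := le_integral_halfSeries hn (m := P + Q + 2) hb hK k hs hM1 hmM (by positivity)
    hlow hint
  rw [cpqk_eq_integral_halfSeries n P Q s k hn hK]
  have hpow : (M : ℝ) ^ (-(2 * n + s + 1)) = ((M : ℝ)⁻¹ ^ n) ^ 2 * (M : ℝ) ^ (-(s + 1)) := by
    rw [← pow_mul, ← Real.rpow_natCast, Real.inv_rpow hM0.le, ← Real.rpow_neg hM0.le,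
        ← Real.rpow_add hM0]
    congr 1; push_cast; ring
  constructor
  · refine le_trans (le_of_eq ?_) hge
    rw [hpow, Real.mul_rpow (by norm_num) hM0.le, pow_succ (M : ℝ)⁻¹]
    field_simp
    ring
  · refine hle.trans (le_of_eq ?_)
    have hτpow : ((M : ℝ) ^ (-τ)) ^ 2 = (M : ℝ) ^ (2 * k) * (M : ℝ) ^ (-(2 * n + s + 1)) := by
      rw [← Real.rpow_natCast, ← Real.rpow_natCast, ← Real.rpow_mul hM0.le, ← Real.rpow_add hM0]
      congr 1; rw [hτ]; push_cast; ring
    linear_combination (Real.Gamma (s + 1) * (A * c₁ * K₁) ^ 2) * hτpow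

/-- Corollary 5.6: `c_{pq,k}(s) ≍ [(p+1)(q+1)]^{2k} c_{pq,0}(s)` for `p+q > 0`. -/
theorem statement14 (n : ℕ) (hn : 2 ≤ n) (s : ℝ) (hs : -1 < s) (k : ℕ) (hk : k ≤ n) :
    ∃ c C : ℝ, 0 < c ∧ c < C ∧ ∀ p q : ℕ, 0 < p + q →
      c * (((p : ℝ) + 1) * ((q : ℝ) + 1)) ^ (2 * k) * cpqk n p q s 0 ≤ cpqk n p q s k ∧
      cpqk n p q s k ≤ C * (((p : ℝ) + 1) * ((q : ℝ) + 1)) ^ (2 * k) * cpqk n p q s 0 := by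
  obtain ⟨κ, K, hκ, hK, h⟩ := exists_cpqk_bounds (by omega : 1 ≤ n) hs hk
  obtain ⟨κ₀, K₀, hκ₀, hK₀, h₀⟩ := exists_cpqk_bounds (by omega : 1 ≤ n) hs (Nat.zero_le n)
  refine ⟨κ / (4 ^ (2 * k) * K₀), κ / (4 ^ (2 * k) * K₀) + K / κ₀, by positivity,
    lt_add_of_pos_right _ (by positivity), fun p q _ => ?_⟩
  by_cases hpq : p = 0 ∨ q = 0
  · simp [cpqk_eq_zero n p q hpq]
  push Not at hpq
  obtain ⟨P, rfl⟩ := Nat.exists_eq_succ_of_ne_zero hpq.1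
  obtain ⟨Q, rfl⟩ := Nat.exists_eq_succ_of_ne_zero hpq.2
  obtain ⟨h1, h2⟩ := h P Q
  obtain ⟨h3, h4⟩ := h₀ P Q
  simp only [Nat.succ_eq_add_one]
  have hP := Nat.cast_nonneg (α := ℝ) P
  have hQ := Nat.cast_nonneg (α := ℝ) Q
  have hPQ := mul_nonneg hP hQ
  have hM4 : (((P + 1 : ℕ) : ℝ) + 1) * (((Q + 1 : ℕ) : ℝ) + 1) ≤
      4 * (((P + 1) * (Q + 1) : ℕ) : ℝ) := by push_cast; nlinarith
  have hM1 : (((P + 1) * (Q + 1) : ℕ) : ℝ) ≤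
      (((P + 1 : ℕ) : ℝ) + 1) * (((Q + 1 : ℕ) : ℝ) + 1) := by push_cast; nlinarith
  have hM0 : (0 : ℝ) < (((P + 1) * (Q + 1) : ℕ) : ℝ) := by positivity
  have hX : 0 < SpqScale n P Q ^ 2 * (((P + 1) * (Q + 1) : ℕ) : ℝ) ^ (-(2 * n + s + 1)) := by
    have := SpqScale_pos (by omega : 0 < n) P Q
    positivity
  set X := SpqScale n P Q ^ 2 * (((P + 1) * (Q + 1) : ℕ) : ℝ) ^ (-(2 * n + s + 1))
  set M := (((P + 1) * (Q + 1) : ℕ) : ℝ)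
  set R := (((P + 1 : ℕ) : ℝ) + 1) * (((Q + 1 : ℕ) : ℝ) + 1)
  rw [mul_zero, pow_zero, mul_one] at h3 h4
  have hc0 : 0 ≤ cpqk n (P + 1) (Q + 1) s 0 := (by positivity : 0 ≤ κ₀ * X).trans h3
  constructor
  · refine le_trans ?_ h1
    calc _ ≤ κ / (4 ^ (2 * k) * K₀) * (4 * M) ^ (2 * k) * (K₀ * X) := by gcongr
      _ = _ := by rw [mul_pow]; field_simp
  · refine h2.trans ?_
    calc _ = K / κ₀ * M ^ (2 * k) * (κ₀ * X) := by field_simp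
      _ ≤ (κ / (4 ^ (2 * k) * K₀) + K / κ₀) * R ^ (2 * k) * cpqk n (P + 1) (Q + 1) s 0 := by
        gcongr
        exact le_add_of_nonneg_left (by positivity)
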